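/- A holomorphic function f on the unit disk has finite local Dirichlet integral at ζ ∈ 𝕋 (i.e., ∫_𝔻 |f'(z)|²·(1-|z|²)/|z-ζ|² dA(z) < ∞) if and only if f(z) = a + (z-ζ)g(z) for some g ∈ H² and a ∈ ℂ; in that case the integral equals ‖g‖²_{H²} and a equals the radial limit of f at ζ. -/

import Mathlib

open MeasureTheory Metric Filter

lemma aux_id (n : ℕ) (g S : ℂ) :
    ‖((n:ℂ)+1) * g - S‖^2 / (((n:ℝ)+1)*(n+2)) = ‖g‖^2 + ‖S‖^2/(n+1) - ‖S+g‖^2/(n+2) := by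
  have h1 : ((n:ℝ)+1) ≠ 0 := by positivity
  have h2 : ((n:ℝ)+2) ≠ 0 := by positivity
  simp only [← Complex.normSq_eq_norm_sq, Complex.normSq_apply]
  field_simp
  simp
  ring

lemma aux_sum (G H : ℕ → ℂ)
    (hrel : ∀ n, H n = ((n:ℂ)+1) * G (n+1) - ∑ k ∈ Finset.range (n+1), G k) (N : ℕ) :
    ∑ n ∈ Finset.range N, ‖H n‖^2 / (((n:ℝ)+1)*(n+2)) =
     ∑ n ∈ Finset.range (N+1), ‖G n‖^2 - ‖∑ k ∈ Finset.range (N+1), G k‖^2/(N+1) := by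
  induction N with
  | zero => simp
  | succ N ih =>
    rw [Finset.sum_range_succ, ih, hrel, aux_id, Finset.sum_range_succ _ (N+1),
      Finset.sum_range_succ G (N+1)]
    push_cast
    ring

lemma sq_sum_le (s : Finset ℕ) (G : ℕ → ℂ) :
    ‖∑ k ∈ s, G k‖^2 ≤ s.card * ∑ k ∈ s, ‖G k‖^2 := by
  calc _ ≤ (∑ k ∈ s, ‖G k‖)^2 := by
        gcongr; exact norm_sum_le _ _
    _ ≤ _ := sq_sum_le_card_mul_sum_sq

lemma aux_tend (G : ℕ → ℂ) (hG : Summable (fun n => ‖G n‖^2)) :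
    Tendsto (fun N : ℕ => ‖∑ k ∈ Finset.range (N+1), G k‖^2/((N:ℝ)+1)) atTop (nhds 0) := by
  rw [Metric.tendsto_atTop]
  intro ε hε
  have ht := hG.hasSum.tendsto_sum_nat
  have hT := fun M => hG.sum_le_tsum (Finset.range M) (fun _ _ => by positivity)
  obtain ⟨M, hM⟩ := (ht.eventually (lt_mem_nhds (show (∑' n, ‖G n‖^2) - ε/8 < ∑' n, ‖G n‖^2 by linarith))).exists
  set SM := ∑ k ∈ Finset.range M, G k
  obtain ⟨N0, hN0⟩ := exists_nat_gt (8 * ‖SM‖^2/ε)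
  refine ⟨max N0 M, fun N hN => ?_⟩
  have hN1 : N0 ≤ N := le_trans (le_max_left _ _) hN
  have hN2 : M ≤ N+1 := le_trans (le_trans (le_max_right _ _) hN) (Nat.le_succ _)
  have hpos : (0:ℝ) < (N:ℝ)+1 := by positivity
  rw [dist_zero_right, Real.norm_of_nonneg (by positivity), div_lt_iff₀ hpos]
  have e1 := Finset.sum_range_add_sum_Ico G hN2
  have e2 := Finset.sum_range_add_sum_Ico (fun k => ‖G k‖^2) hN2
  rw [← e1]
  have h3 := sq_sum_le (Finset.Ico M (N+1)) G
  have h4 : ∑ k ∈ Finset.Ico M (N+1), ‖G k‖^2 ≤ ε/8 := by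
    have := hT (N+1); linarith
  have h5 : ((Finset.Ico M (N+1)).card : ℝ) ≤ N+1 := by
    rw [Nat.card_Ico]
    exact_mod_cast Nat.sub_le _ _
  have h6 : ‖∑ k ∈ Finset.Ico M (N+1), G k‖^2 ≤ (N+1) * (ε/8) :=
    h3.trans (mul_le_mul h5 h4 (by positivity) hpos.le)
  have h7 : ‖SM + ∑ k ∈ Finset.Ico M (N+1), G k‖^2 ≤ 2*‖SM‖^2 + 2*‖∑ k ∈ Finset.Ico M (N+1), G k‖^2 := by
    have := norm_add_le SM (∑ k ∈ Finset.Ico M (N+1), G k)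
    calc _ ≤ (‖SM‖ + ‖∑ k ∈ Finset.Ico M (N+1), G k‖)^2 := by gcongr
      _ ≤ _ := by nlinarith [sq_nonneg (‖SM‖ - ‖∑ k ∈ Finset.Ico M (N+1), G k‖)]
  have h8 : 8 * ‖SM‖^2 < ε * (N+1) := by
    rw [div_lt_iff₀ hε] at hN0
    have : (N0:ℝ) ≤ N := by exact_mod_cast hN1
    nlinarith
  nlinarith

lemma aux_fwd (G H : ℕ → ℂ)
    (hrel : ∀ n, H n = ((n:ℂ)+1) * G (n+1) - ∑ k ∈ Finset.range (n+1), G k)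
    (hG : Summable (fun n => ‖G n‖^2)) :
    HasSum (fun n : ℕ => ‖H n‖^2 / (((n:ℝ)+1)*(n+2))) (∑' n, ‖G n‖^2) := by
  rw [hasSum_iff_tendsto_nat_of_nonneg (fun _ => by positivity)]
  simp only [aux_sum G H hrel]
  have := ((tendsto_add_atTop_iff_nat 1).2 hG.hasSum.tendsto_sum_nat).sub (aux_tend G hG)
  simpa using this

lemma wsum (M N : ℕ) (h : M ≤ N) :
   ∑ k ∈ Finset.Ico M N, (1:ℝ)/(((k:ℝ)+1)*(k+2)) = 1/((M:ℝ)+1) - 1/((N:ℝ)+1) := by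
  induction N, h using Nat.le_induction with
  | base => simp
  | succ N h ih =>
    rw [Finset.sum_Ico_succ_top h, ih]
    push_cast
    field_simp
    ring

lemma wcs (H : ℕ → ℂ) (M N : ℕ) (h : M ≤ N) :
    (∑ k ∈ Finset.Ico M N, ‖H k / (((k:ℂ)+1)*(k+2))‖)^2 ≤
     (∑ k ∈ Finset.Ico M N, ‖H k‖^2 / (((k:ℝ)+1)*(k+2))) * (1/((M:ℝ)+1)) := by
  have key := Finset.sum_mul_sq_le_sq_mul_sq (Finset.Ico M N)
    (fun k => ‖H k‖ / √(((k:ℝ)+1)*(k+2))) (fun k => 1/ √(((k:ℝ)+1)*(k+2)))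
  have e1 : ∀ k : ℕ, ‖H k‖ / √(((k:ℝ)+1)*(k+2)) * (1/ √(((k:ℝ)+1)*(k+2))) = ‖H k / (((k:ℂ)+1)*(k+2))‖ := by
    intro k
    rw [div_mul_div_comm, Real.mul_self_sqrt (by positivity), mul_one, norm_div]
    congr 1
    have : (((k:ℂ)+1)*(k+2)) = (((((k:ℝ)+1)*(k+2)) : ℝ) : ℂ) := by push_cast; ring
    rw [this, Complex.norm_real, Real.norm_of_nonneg (by positivity)]
  have e2 : ∀ k : ℕ, (‖H k‖ / √(((k:ℝ)+1)*(k+2)))^2 = ‖H k‖^2 / (((k:ℝ)+1)*(k+2)) := by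
    intro k
    rw [div_pow, Real.sq_sqrt (by positivity)]
  have e3 : ∀ k : ℕ, (1 / √(((k:ℝ)+1)*(k+2)))^2 = 1 / (((k:ℝ)+1)*(k+2)) := by
    intro k
    rw [div_pow, Real.sq_sqrt (by positivity), one_pow]
  simp only [e1, e2, e3] at key
  rw [wsum M N h] at key
  refine key.trans ?_
  have : (0:ℝ) ≤ 1/((N:ℝ)+1) := by positivity
  gcongr
  linarith

lemma wsummable (H : ℕ → ℂ) (hH : Summable (fun n : ℕ => ‖H n‖^2 / (((n:ℝ)+1)*(n+2)))) :
    Summable (fun n : ℕ => H n / (((n:ℂ)+1)*(n+2))) := by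
  apply Summable.of_norm
  refine summable_of_sum_range_le (c := √(∑' n : ℕ, ‖H n‖^2 / (((n:ℝ)+1)*(n+2)))) (fun _ => norm_nonneg _) (fun N => ?_)
  apply Real.le_sqrt_of_sq_le
  have := wcs H 0 N (Nat.zero_le _)
  simp only [← Finset.range_eq_Ico] at this
  refine this.trans ?_
  have := hH.sum_le_tsum (Finset.range N) (fun _ _ => by positivity)
  simpa using this

lemma aux_bwd (G H : ℕ → ℂ)
    (hrel : ∀ n, H n = ((n:ℂ)+1) * G (n+1) - ∑ k ∈ Finset.range (n+1), G k)
    (hH : Summable (fun n : ℕ => ‖H n‖^2 / (((n:ℝ)+1)*(n+2))))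
    (h0 : G 0 = - ∑' n : ℕ, H n / (((n:ℂ)+1)*(n+2))) :
    Summable (fun n => ‖G n‖^2) := by
  set T := ∑' n : ℕ, ‖H n‖^2 / (((n:ℝ)+1)*(n+2))
  have hs := wsummable H hH
  have hT := fun s => hH.sum_le_tsum s (fun _ _ => by positivity)
  have hM : ∀ N : ℕ, (∑ k ∈ Finset.range (N+1), G k) / ((N:ℂ)+1) =
      G 0 + ∑ k ∈ Finset.range N, H k / (((k:ℂ)+1)*(k+2)) := by
    intro N
    induction N with
    | zero => simp
    | succ N ih =>
      have a1 : ((N:ℂ)+1) ≠ 0 := by exact_mod_cast Nat.succ_ne_zero N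
      have a2 : ((N:ℂ)+2) ≠ 0 := by exact_mod_cast Nat.succ_ne_zero (N+1)
      have a3 : ((N:ℂ)+1+1) ≠ 0 := by exact_mod_cast Nat.succ_ne_zero (N+1)
      rw [Finset.sum_range_succ (fun k : ℕ => H k / (((k:ℂ)+1)*(k+2))), ← add_assoc, ← ih, hrel, Finset.sum_range_succ _ (N+1)]
      push_cast
      field_simp
      ring
  have hb : ∀ N : ℕ, ‖∑ k ∈ Finset.range (N+1), G k‖^2/((N:ℝ)+1) ≤ T := by
    intro N
    have hlim : Tendsto (fun K => (∑ k ∈ Finset.range K, H k / (((k:ℂ)+1)*(k+2))) - ∑ k ∈ Finset.range N, H k / (((k:ℂ)+1)*(k+2))) atTop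
        (nhds (-((∑ k ∈ Finset.range (N+1), G k) / ((N:ℂ)+1)))) := by
      have := hs.hasSum.tendsto_sum_nat.sub_const (∑ k ∈ Finset.range N, H k / (((k:ℂ)+1)*(k+2)))
      convert this using 2
      rw [hM, h0]; ring
    have hle : ‖-((∑ k ∈ Finset.range (N+1), G k) / ((N:ℂ)+1))‖^2 ≤ T * (1/((N:ℝ)+1)) := by
      refine le_of_tendsto (hlim.norm.pow 2) ?_
      filter_upwards [eventually_ge_atTop N] with K hK
      rw [← Finset.sum_Ico_eq_sub _ hK]
      calc _ ≤ (∑ k ∈ Finset.Ico N K, ‖H k / (((k:ℂ)+1)*(k+2))‖)^2 := by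
            gcongr; exact norm_sum_le _ _
        _ ≤ _ := wcs H N K hK
        _ ≤ _ := by gcongr; exact hT _
    have e : ‖(N:ℂ)+1‖ = (N:ℝ)+1 := by
      have : ((N:ℂ)+1) = (((N:ℝ)+1 : ℝ):ℂ) := by push_cast; ring
      rw [this, Complex.norm_real, Real.norm_of_nonneg (by positivity)]
    rw [norm_neg, norm_div, e, div_pow] at hle
    have hp : (0:ℝ) < (N:ℝ)+1 := by positivity
    rw [div_le_iff₀ (by positivity)] at hle
    rw [div_le_iff₀ hp]
    refine hle.trans (le_of_eq ?_)
    field_simp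
  refine summable_of_sum_range_le (c := T + T) (fun _ => by positivity) (fun N => ?_)
  have h1 := aux_sum G H hrel N
  have h2 := hT (Finset.range N)
  have h3 := hb N
  have h4 : ∑ n ∈ Finset.range N, ‖G n‖^2 ≤ ∑ n ∈ Finset.range (N+1), ‖G n‖^2 := by
    rw [Finset.sum_range_succ]; linarith [sq_nonneg ‖G N‖]
  linarith

noncomputable def tc (g : ℂ → ℂ) (n : ℕ) : ℂ := iteratedDeriv n g 0 / (n.factorial : ℂ)

lemma tc_deriv (f : ℂ → ℂ) (n : ℕ) : tc (deriv f) n = ((n:ℂ)+1) * tc f (n+1) := by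
  unfold tc
  rw [iteratedDeriv_succ', Nat.factorial_succ]
  have : ((n:ℂ)+1) ≠ 0 := by exact_mod_cast Nat.succ_ne_zero n
  have : (n.factorial:ℂ) ≠ 0 := by exact_mod_cast n.factorial_ne_zero
  push_cast
  field_simp

lemma it_mul (ζ : ℂ) (F G : ℂ → ℂ) (a : ℂ) (hG : DifferentiableOn ℂ G (ball 0 1))
    (h : ∀ z ∈ ball (0:ℂ) 1, F z = a + (z - ζ) * G z) (n : ℕ) :
    ∀ z ∈ ball (0:ℂ) 1, iteratedDeriv (n+1) F z =
      ((n:ℂ)+1) * iteratedDeriv n G z + (z-ζ) * iteratedDeriv (n+1) G z := by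
  have hd : ∀ n, DifferentiableOn ℂ (iteratedDeriv n G) (ball 0 1) := by
    intro n
    induction n with
    | zero => simpa using hG
    | succ n ih => rw [iteratedDeriv_succ]; exact ih.deriv isOpen_ball
  have hd' : ∀ n, ∀ z ∈ ball (0:ℂ) 1, HasDerivAt (iteratedDeriv n G) (iteratedDeriv (n+1) G z) z := by
    intro n z hz
    rw [iteratedDeriv_succ]
    exact ((hd n).differentiableAt (isOpen_ball.mem_nhds hz)).hasDerivAt
  induction n with
  | zero =>
    intro z hz
    rw [iteratedDeriv_one]
    have e : F =ᶠ[nhds z] fun z => a + (z - ζ) * G z := by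
      filter_upwards [isOpen_ball.mem_nhds hz] with w hw using h w hw
    rw [e.deriv_eq]
    have := ((((hasDerivAt_id z).sub_const ζ).mul (hd' 0 z hz)).const_add a)
    rw [iteratedDeriv_zero] at this
    refine (this.deriv).trans ?_
    simp
  | succ n ih =>
    intro z hz
    rw [iteratedDeriv_succ]
    have e : iteratedDeriv (n+1) F =ᶠ[nhds z] fun z => ((n:ℂ)+1) * iteratedDeriv n G z + (z-ζ) * iteratedDeriv (n+1) G z := by
      filter_upwards [isOpen_ball.mem_nhds hz] with w hw using ih w hw
    rw [e.deriv_eq]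
    have := ((hd' n z hz).const_mul ((n:ℂ)+1)).add (((hasDerivAt_id z).sub_const ζ).mul (hd' (n+1) z hz))
    refine (this.deriv).trans ?_
    simp
    ring

lemma tc_mul (ζ : ℂ) (F G : ℂ → ℂ) (a : ℂ) (hG : DifferentiableOn ℂ G (ball 0 1))
    (h : ∀ z ∈ ball (0:ℂ) 1, F z = a + (z - ζ) * G z) (n : ℕ) :
    tc F (n+1) = tc G n - ζ * tc G (n+1) := by
  unfold tc
  rw [it_mul ζ F G a hG h n 0 (by simp), Nat.factorial_succ]
  have : ((n:ℂ)+1) ≠ 0 := by exact_mod_cast Nat.succ_ne_zero n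
  have : (n.factorial:ℂ) ≠ 0 := by exact_mod_cast n.factorial_ne_zero
  push_cast
  field_simp
  ring

lemma tc_zero (F : ℂ → ℂ) : tc F 0 = F 0 := by simp [tc]

lemma tc_hasSum (F : ℂ → ℂ) (hF : DifferentiableOn ℂ F (ball 0 1)) (z : ℂ) (hz : z ∈ ball (0:ℂ) 1) :
    HasSum (fun n => tc F n * z^n) (F z) := by
  convert! Complex.hasSum_taylorSeries_on_ball hF hz using 2 with n
  simp only [tc, smul_eq_mul, sub_zero]; ring

lemma rel (ζ : ℂ) (f g h : ℂ → ℂ) (a : ℂ)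
    (hg : DifferentiableOn ℂ g (ball 0 1)) (hh : DifferentiableOn ℂ h (ball 0 1))
    (h1 : ∀ z ∈ ball (0:ℂ) 1, f z = a + (z - ζ) * g z)
    (h2 : ∀ z ∈ ball (0:ℂ) 1, deriv f z = (z - ζ) * h z) (n : ℕ) :
    ζ^(n+1) * tc h n = ((n:ℂ)+1) * (ζ^(n+1) * tc g (n+1)) -
      ∑ k ∈ Finset.range (n+1), ζ^k * tc g k := by
  induction n with
  | zero =>
    have e1 := tc_deriv f 0
    rw [tc_mul ζ f g a hg h1, tc_zero, h2 0 (by simp)] at e1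
    simp [tc_zero] at e1 ⊢
    linear_combination -e1
  | succ n ih =>
    have e1 := tc_deriv f (n+1)
    rw [tc_mul ζ f g a hg h1, tc_mul ζ (deriv f) h 0 hh (by simpa using h2)] at e1
    rw [Finset.sum_range_succ]
    push_cast at e1 ⊢
    linear_combination ih - ζ^(n+1) * e1

lemma parseval (a : ℕ → ℂ) (ha : Summable (fun n => ‖a n‖)) (F : ℝ → ℂ)
    (hF : ∀ t : ℝ, HasSum (fun n => a n * Complex.exp (t * Complex.I)^n) (F t)) :
    ∫⁻ t in Set.Ioo (-Real.pi) Real.pi, ENNReal.ofReal (‖F t‖^2) =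
      ENNReal.ofReal (2*Real.pi) * ∑' n, ENNReal.ofReal (‖a n‖^2) := by
  have hpi := Real.pi_pos
  have hne : ∀ t : ℝ, ‖Complex.exp (t * Complex.I)‖ = 1 := Complex.norm_exp_ofReal_mul_I
  have hsa : Summable (fun p : ℕ × ℕ => ‖a p.1‖ * ‖a p.2‖) := by
    exact ha.mul_of_nonneg ha (fun _ => norm_nonneg _) (fun _ => norm_nonneg _)
  let u : ℕ × ℕ → ℝ → ℂ := fun p t => (a p.1 * Complex.exp (t * Complex.I)^p.1) *
    (starRingEnd ℂ) (a p.2 * Complex.exp (t * Complex.I)^p.2)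
  have hnu : ∀ p t, ‖u p t‖ = ‖a p.1‖ * ‖a p.2‖ := by
    intro p t; simp [u, hne]
  have hu : ∀ t, HasSum (fun p => u p t) ((‖F t‖^2 : ℝ) : ℂ) := by
    intro t
    have h1 := hF t
    have h2 := Complex.hasSum_conj'.2 (hF t)
    have h3 := h1.mul h2 (by
      apply Summable.of_norm
      exact hsa.congr (fun p => (hnu p t).symm))
    convert! h3 using 1
    rw [Complex.mul_conj, Complex.normSq_eq_norm_sq]
  have hint : ∀ p : ℕ × ℕ, ∫ t in Set.Ioo (-Real.pi) Real.pi, u p t = if p.1 = p.2 then ((2 * Real.pi * ‖a p.1‖^2 : ℝ) : ℂ) else 0 := by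
    rintro ⟨m, n⟩
    have e : ∀ t : ℝ, u (m,n) t = (a m * (starRingEnd ℂ) (a n)) * Complex.exp ((((m:ℂ) - n) * Complex.I) * t) := by
      intro t
      simp only [u, map_mul, ← Complex.exp_conj, ← Complex.exp_nat_mul, Complex.conj_ofReal, Complex.conj_I, Complex.conj_natCast]
      rw [mul_mul_mul_comm, ← Complex.exp_add]
      congr 2; ring
    rw [← integral_Ioc_eq_integral_Ioo, ← intervalIntegral.integral_of_le (by linarith)]
    simp only [e]
    rw [intervalIntegral.integral_const_mul]
    split_ifs with hmn
    · subst hmn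
      simp [Complex.mul_conj, Complex.normSq_eq_norm_sq]
      ring
    · have hmn' : ((m:ℂ) - n) ≠ 0 := by
        rw [sub_ne_zero]; exact_mod_cast hmn
      rw [integral_exp_mul_complex (by simp [hmn'])]
      have : Complex.exp (((m:ℂ) - n) * Complex.I * (Real.pi:ℝ)) = Complex.exp (((m:ℂ) - n) * Complex.I * ((-Real.pi:ℝ):ℂ)) := by
        rw [Complex.exp_eq_exp_iff_exists_int]
        refine ⟨(m:ℤ)-n, ?_⟩
        push_cast; ring
      rw [this]; simp
  have hcont : ∀ p, Continuous (u p) := by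
    intro p; simp only [u]; fun_prop
  have hI : ∀ p, Integrable (u p) (volume.restrict (Set.Ioo (-Real.pi) Real.pi)) := by
    intro p
    exact ((hcont p).integrableOn_Icc).mono_set Set.Ioo_subset_Icc_self
  have hS : Summable (fun p => ∫ t in Set.Ioo (-Real.pi) Real.pi, ‖u p t‖) := by
    simp only [hnu]
    simp only [integral_const]
    exact hsa.const_smul _
  have hmain := hasSum_integral_of_summable_integral_norm hI hS
  have e2 : ∀ t, ∑' p, u p t = ((‖F t‖^2 : ℝ) : ℂ) := fun t => (hu t).tsum_eq
  simp only [e2, hint] at hmain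
  rw [integral_complex_ofReal] at hmain
  have hsq : Summable (fun n => ‖a n‖^2) := by
    have := hsa.comp_injective (i := fun n : ℕ => (n,n)) (fun a b h => (Prod.ext_iff.1 h).1)
    refine this.congr (fun n => ?_)
    simp [sq]
  have hdiag : HasSum (fun n => ((2 * Real.pi * ‖a n‖^2 : ℝ) : ℂ)) ((∫ t in Set.Ioo (-Real.pi) Real.pi, ‖F t‖^2 : ℝ) : ℂ) := by
    have hinj : Function.Injective (fun n : ℕ => (n,n)) := (fun a b h => (Prod.ext_iff.1 h).1)
    rw [← hinj.hasSum_iff] at hmain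
    · refine hmain.congr_fun ?_
      intro n; simp
    · rintro ⟨m, n⟩ hmn
      rw [if_neg]
      intro hmn'
      exact hmn ⟨m, Prod.ext rfl hmn'⟩
  have hdiag' := (Complex.hasSum_ofReal.1 hdiag)
  have hFm : Continuous F := by
    have : F = fun t : ℝ => ∑' n, a n * Complex.exp (t * Complex.I)^n := by
      ext t; exact (hF t).tsum_eq.symm
    rw [this]
    refine continuous_tsum (fun n => by fun_prop) ha (fun n t => ?_)
    simp [hne]
  rw [← ofReal_integral_eq_lintegral_ofReal, ← hdiag'.tsum_eq, tsum_mul_left, ENNReal.ofReal_mul (by positivity), ENNReal.ofReal_tsum_of_nonneg (fun _ => by positivity) hsq]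
  · have : Continuous fun t => ‖F t‖^2 := by fun_prop
    exact (this.integrableOn_Icc).mono_set Set.Ioo_subset_Icc_self
  · exact Eventually.of_forall (fun _ => by positivity)

lemma radial (n : ℕ) (c : ℝ) (hc : 0 ≤ c) :
    ∫⁻ r in Set.Ioo (0:ℝ) 1, ENNReal.ofReal (2 * Real.pi * (r * (1-r^2) * (c * (r^n)^2))) =
      ENNReal.ofReal Real.pi * ENNReal.ofReal (c / (((n:ℝ)+1)*(n+2))) := by
  have hpi := Real.pi_pos
  have hcont : Continuous (fun r : ℝ => 2 * Real.pi * (r * (1-r^2) * (c * (r^n)^2))) := by fun_prop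
  rw [← ofReal_integral_eq_lintegral_ofReal, ← ENNReal.ofReal_mul hpi.le]
  · congr 1
    rw [← integral_Ioc_eq_integral_Ioo, ← intervalIntegral.integral_of_le (by norm_num)]
    have e : ∀ r : ℝ, 2 * Real.pi * (r * (1-r^2) * (c * (r^n)^2)) =
       (2 * Real.pi * c) * (r^(2*n+1) - r^(2*n+3)) := by intro r; ring
    simp only [e]
    rw [intervalIntegral.integral_const_mul, intervalIntegral.integral_sub
      ((continuous_pow _).intervalIntegrable _ _) ((continuous_pow _).intervalIntegrable _ _),
      integral_pow, integral_pow]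
    push_cast
    have : ((n:ℝ)+1) ≠ 0 := by positivity
    have : ((n:ℝ)+2) ≠ 0 := by positivity
    have : (2*(n:ℝ)+1+1) ≠ 0 := by positivity
    have : (2*(n:ℝ)+3+1) ≠ 0 := by positivity
    simp
    field_simp
    ring
  · exact (hcont.integrableOn_Icc).mono_set Set.Ioo_subset_Icc_self
  · refine (ae_restrict_mem measurableSet_Ioo).mono (fun r hr => ?_)
    have h1 := hr.1
    have h2 : (0:ℝ) ≤ 1 - r^2 := by nlinarith [hr.1, hr.2]
    simp only [Pi.zero_apply]
    positivity

lemma disk (h : ℂ → ℂ) (hh : DifferentiableOn ℂ h (ball 0 1)) :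
    ∫⁻ z in ball (0:ℂ) 1, ENNReal.ofReal (‖h z‖^2 * (1 - ‖z‖^2)) =
      ENNReal.ofReal Real.pi * ∑' n : ℕ, ENNReal.ofReal (‖tc h n‖^2 / (((n:ℝ)+1)*(n+2))) := by
  classical
  have hpi := Real.pi_pos
  set k : ℂ → ENNReal := fun z => ENNReal.ofReal (‖h z‖^2 * (1 - ‖z‖^2)) with hk
  have hkc : ContinuousOn k (ball 0 1) := by
    have := hh.continuousOn
    apply ENNReal.continuous_ofReal.comp_continuousOn
    fun_prop
  have hKm : Measurable ((ball (0:ℂ) 1).indicator k) := by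
    rw [← Set.piecewise_eq_indicator]
    exact hkc.measurable_piecewise continuousOn_const measurableSet_ball
  rw [← lintegral_indicator measurableSet_ball, ← Complex.lintegral_comp_polarCoord_symm,
    polarCoord_target, Measure.volume_eq_prod, setLIntegral_prod]
  swap
  · have hm : Measurable (fun p : ℝ × ℝ => Complex.polarCoord.symm p) := by
      simp only [Complex.polarCoord_symm_apply]
      fun_prop
    have := (measurable_fst (α := ℝ) (β := ℝ)).ennreal_ofReal.mul (hKm.comp hm)
    exact this.aemeasurable
  have hin : ∀ r ∈ Set.Ioi (0:ℝ), ∫⁻ t in Set.Ioo (-Real.pi) Real.pi,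
      ENNReal.ofReal (r, t).1 • (ball (0:ℂ) 1).indicator k (Complex.polarCoord.symm (r, t)) =
      (Set.Iio (1:ℝ)).indicator (fun r => ∑' n : ℕ, ENNReal.ofReal (2 * Real.pi * (r * (1-r^2) * (‖tc h n‖^2 * (r^n)^2)))) r := by
    intro r hr
    have hr0 : 0 < r := hr
    have hsym : ∀ t : ℝ, Complex.polarCoord.symm (r, t) = r * Complex.exp (t * Complex.I) := by
      intro t
      rw [Complex.polarCoord_symm_apply, Complex.exp_mul_I]
      simp
    have hnorm : ∀ t : ℝ, ‖(r:ℂ) * Complex.exp (t * Complex.I)‖ = r := by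
      intro t
      rw [norm_mul, Complex.norm_exp_ofReal_mul_I, Complex.norm_real, Real.norm_of_nonneg hr0.le, mul_one]
    simp only [hsym]
    by_cases h1 : r < 1
    · have hmem : ∀ t : ℝ, (r:ℂ) * Complex.exp (t * Complex.I) ∈ ball (0:ℂ) 1 := by
        intro t; rw [mem_ball_zero_iff, hnorm]; exact h1
      have h2 : (0:ℝ) ≤ 1 - r^2 := by nlinarith
      rw [Set.indicator_of_mem (by exact h1)]
      simp only [Set.indicator_of_mem (hmem _), hk, hnorm, smul_eq_mul]
      have e1 : ∀ t : ℝ, ENNReal.ofReal r * ENNReal.ofReal (‖h (r * Complex.exp (t * Complex.I))‖^2 * (1-r^2)) =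
          ENNReal.ofReal (r * (1-r^2)) * ENNReal.ofReal (‖h (r * Complex.exp (t * Complex.I))‖^2) := by
        intro t
        rw [← ENNReal.ofReal_mul hr0.le, ← ENNReal.ofReal_mul (by positivity)]
        congr 1; ring
      simp only [e1]
      rw [lintegral_const_mul' _ _ ENNReal.ofReal_ne_top,
        parseval (fun n => tc h n * (r:ℂ)^n) ?_ (fun t : ℝ => h (r * Complex.exp (t * Complex.I))) ?_]
      · rw [← mul_assoc, ← ENNReal.tsum_mul_left]
        congr 1
        ext n
        rw [← ENNReal.ofReal_mul (by positivity), ← ENNReal.ofReal_mul (by positivity)]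
        congr 1
        rw [norm_mul, norm_pow, Complex.norm_real, Real.norm_of_nonneg hr0.le]
        ring
      · have := (tc_hasSum h hh (r:ℂ) (by rw [mem_ball_zero_iff, Complex.norm_real, Real.norm_of_nonneg hr0.le]; exact h1)).summable
        exact this.norm
      · intro t
        convert! tc_hasSum h hh _ (hmem t) using 2 with n
        rw [mul_pow]; ring
    · have hmem : ∀ t : ℝ, (r:ℂ) * Complex.exp (t * Complex.I) ∉ ball (0:ℂ) 1 := by
        intro t; rw [mem_ball_zero_iff, hnorm]; exact h1
      rw [Set.indicator_of_notMem (by exact h1)]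
      simp only [Set.indicator_of_notMem (hmem _)]
      simp
  rw [setLIntegral_congr_fun measurableSet_Ioi hin, lintegral_indicator measurableSet_Iio,
    Measure.restrict_restrict measurableSet_Iio, Set.inter_comm, Set.Ioi_inter_Iio, lintegral_tsum,
    ← ENNReal.tsum_mul_left]
  · congr 1
    ext n
    exact radial n _ (by positivity)
  · intro n
    apply Measurable.aemeasurable
    fun_prop

lemma radlim (ζ : ℂ) (hζ : ‖ζ‖ = 1) (f g : ℂ → ℂ) (a : ℂ) (hg : DifferentiableOn ℂ g (ball 0 1))
    (hs : Summable (fun n => ‖tc g n‖^2)) (h1 : ∀ z ∈ ball (0:ℂ) 1, f z = a + (z - ζ) * g z) :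
    Tendsto (fun r : ℝ => f ((r : ℂ) * ζ)) (nhdsWithin 1 (Set.Iio 1)) (nhds a) := by
  rw [tendsto_iff_norm_sub_tendsto_zero]
  set C := ∑' n, ‖tc g n‖^2
  have hlim : Tendsto (fun r : ℝ => √(1-r) * (C+1)) (nhdsWithin 1 (Set.Iio 1)) (nhds 0) := by
    have : Continuous (fun r : ℝ => √(1-r) * (C+1)) := by fun_prop
    have := this.tendsto 1
    simp only [sub_self, Real.sqrt_zero, zero_mul] at this
    exact this.mono_left nhdsWithin_le_nhds
  refine squeeze_zero' (Eventually.of_forall fun _ => norm_nonneg _) ?_ hlim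
  filter_upwards [Ioo_mem_nhdsLT (show (0:ℝ) < 1 by norm_num)] with r hr
  obtain ⟨hr0, hr1⟩ := hr
  have hn : ‖(r:ℂ) * ζ‖ = r := by
    rw [norm_mul, hζ, Complex.norm_real, Real.norm_of_nonneg hr0.le, mul_one]
  have hmem : (r:ℂ) * ζ ∈ ball (0:ℂ) 1 := by rw [mem_ball_zero_iff, hn]; exact hr1
  set s := √(1-r) with hsdef
  have hs0 : 0 < s := Real.sqrt_pos.2 (by linarith)
  have hs2 : s^2 = 1 - r := Real.sq_sqrt (by linarith)
  have hb : ∀ n, ‖tc g n * ((r:ℂ)*ζ)^n‖ ≤ ‖tc g n‖^2 * s⁻¹ + s * r^n := by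
    intro n
    rw [norm_mul, norm_pow, hn]
    have hrn : 0 ≤ r^n := by positivity
    have hrn1 : r^n ≤ 1 := pow_le_one₀ hr0.le hr1.le
    have : ‖tc g n‖ * r^n ≤ ‖tc g n‖^2 * s⁻¹ + s * (r^n)^2 := by
      have hh : 0 ≤ s⁻¹ * ((‖tc g n‖ - s * r^n)^2 + ‖tc g n‖ * (s * r^n)) := by positivity
      have e : s⁻¹ * ((‖tc g n‖ - s * r^n)^2 + ‖tc g n‖ * (s * r^n)) = ‖tc g n‖^2 * s⁻¹ + s * (r^n)^2 - ‖tc g n‖ * r^n := by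
        field_simp; ring
      linarith
    have h3 : s * (r^n)^2 ≤ s * r^n := by
      gcongr; nlinarith
    linarith
  have hgeo := (hasSum_geometric_of_lt_one hr0.le hr1).mul_left s
  have hub := (hs.hasSum.mul_right s⁻¹).add hgeo
  have hgb : ‖g ((r:ℂ)*ζ)‖ ≤ C * s⁻¹ + s * (1-r)⁻¹ := by
    rw [← (tc_hasSum g hg _ hmem).tsum_eq]
    exact tsum_of_norm_bounded hub hb
  rw [h1 _ hmem, add_sub_cancel_left, norm_mul]
  have e : ‖(r:ℂ) * ζ - ζ‖ = 1 - r := by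
    have : (r:ℂ) * ζ - ζ = ((r - 1 : ℝ):ℂ) * ζ := by push_cast; ring
    rw [this, norm_mul, hζ, Complex.norm_real, Real.norm_of_nonpos (by linarith)]; ring
  rw [e, ← hs2]
  rw [← hs2] at hgb
  calc s^2 * ‖g ((r:ℂ)*ζ)‖ ≤ s^2 * (C * s⁻¹ + s * (s^2)⁻¹) := by gcongr
    _ = s * (C+1) := by field_simp

theorem stmt15 (ζ : ℂ) (hζ : ‖ζ‖ = 1) (f : ℂ → ℂ)
    (hf : DifferentiableOn ℂ f (ball (0 : ℂ) 1)) :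
    (IntegrableOn (fun z : ℂ => ‖deriv f z‖ ^ 2 * (1 - ‖z‖ ^ 2) / ‖z - ζ‖ ^ 2)
        (ball (0 : ℂ) 1) volume ↔
      ∃ (a : ℂ) (g : ℂ → ℂ), DifferentiableOn ℂ g (ball (0 : ℂ) 1) ∧
        Summable (fun n : ℕ => ‖iteratedDeriv n g 0 / (n.factorial : ℂ)‖ ^ 2) ∧
        ∀ z ∈ ball (0 : ℂ) 1, f z = a + (z - ζ) * g z) ∧
    ∀ (a : ℂ) (g : ℂ → ℂ), DifferentiableOn ℂ g (ball (0 : ℂ) 1) →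
      Summable (fun n : ℕ => ‖iteratedDeriv n g 0 / (n.factorial : ℂ)‖ ^ 2) →
      (∀ z ∈ ball (0 : ℂ) 1, f z = a + (z - ζ) * g z) →
      (Real.pi⁻¹ * ∫ z in ball (0 : ℂ) 1, ‖deriv f z‖ ^ 2 * (1 - ‖z‖ ^ 2) / ‖z - ζ‖ ^ 2)
          = (∑' n : ℕ, ‖iteratedDeriv n g 0 / (n.factorial : ℂ)‖ ^ 2) ∧
        Tendsto (fun r : ℝ => f ((r : ℂ) * ζ)) (nhdsWithin 1 (Set.Iio 1)) (nhds a) := by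
  have hpi := Real.pi_pos
  have hζ0 : ζ ≠ 0 := by rintro rfl; simp at hζ
  have hne : ∀ z ∈ ball (0:ℂ) 1, z - ζ ≠ 0 := by
    intro z hz h0
    rw [sub_eq_zero] at h0
    rw [mem_ball_zero_iff, h0, hζ] at hz
    exact lt_irrefl _ hz
  set h : ℂ → ℂ := fun z => deriv f z / (z - ζ) with hdef
  have hh : DifferentiableOn ℂ h (ball 0 1) :=
    (hf.deriv isOpen_ball).div (by fun_prop) hne
  have hfh : ∀ z ∈ ball (0:ℂ) 1, deriv f z = (z - ζ) * h z := by
    intro z hz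
    have := hne z hz
    simp only [hdef]; field_simp
  have hfun : (fun z : ℂ => ‖deriv f z‖ ^ 2 * (1 - ‖z‖ ^ 2) / ‖z - ζ‖ ^ 2) =
      fun z => ‖h z‖^2 * (1 - ‖z‖^2) := by
    ext z; simp only [hdef, norm_div, div_pow]; ring
  rw [hfun]
  have hnn : 0 ≤ᵐ[volume.restrict (ball (0:ℂ) 1)] fun z => ‖h z‖^2 * (1 - ‖z‖^2) := by
    refine (ae_restrict_mem measurableSet_ball).mono (fun z hz => ?_)
    rw [mem_ball_zero_iff] at hz
    have : 0 ≤ 1 - ‖z‖^2 := by nlinarith [norm_nonneg z]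
    simp only [Pi.zero_apply]
    positivity
  have hms : AEStronglyMeasurable (fun z => ‖h z‖^2 * (1 - ‖z‖^2)) (volume.restrict (ball (0:ℂ) 1)) := by
    have := hh.continuousOn
    refine ContinuousOn.aestronglyMeasurable ?_ measurableSet_ball
    fun_prop
  have hD := disk h hh
  have hnorm : ∀ (u : ℂ → ℂ) (n m : ℕ), ‖ζ^m * tc u n‖^2 = ‖tc u n‖^2 := by
    intro u n m; rw [norm_mul, norm_pow, hζ, one_pow, one_mul]
  have hInt : IntegrableOn (fun z => ‖h z‖^2 * (1 - ‖z‖^2)) (ball (0:ℂ) 1) volume ↔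
      Summable (fun n : ℕ => ‖tc h n‖^2 / (((n:ℝ)+1)*(n+2))) := by
    rw [IntegrableOn, Integrable, and_iff_right hms, hasFiniteIntegral_iff_ofReal hnn, hD]
    constructor
    · intro hlt
      have h2 : (∑' n : ℕ, ENNReal.ofReal (‖tc h n‖^2 / (((n:ℝ)+1)*(n+2)))) ≠ ⊤ := by
        intro htop
        rw [htop, ENNReal.mul_top (by simpa using hpi)] at hlt
        exact lt_irrefl _ hlt
      have := ENNReal.summable_toReal h2
      refine this.congr (fun n => ?_)
      rw [ENNReal.toReal_ofReal (by positivity)]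
    · intro hs
      rw [← ENNReal.ofReal_tsum_of_nonneg (fun _ => by positivity) hs]
      exact ENNReal.mul_lt_top ENNReal.ofReal_lt_top ENNReal.ofReal_lt_top
  have hfwd : ∀ (a : ℂ) (g : ℂ → ℂ), DifferentiableOn ℂ g (ball (0 : ℂ) 1) →
      Summable (fun n : ℕ => ‖tc g n‖ ^ 2) →
      (∀ z ∈ ball (0 : ℂ) 1, f z = a + (z - ζ) * g z) →
      HasSum (fun n : ℕ => ‖tc h n‖^2 / (((n:ℝ)+1)*(n+2))) (∑' n, ‖tc g n‖^2) := by
    intro a g hg hs h1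
    have := aux_fwd (fun n => ζ^n * tc g n) (fun n => ζ^(n+1) * tc h n)
      (rel ζ f g h a hg hh h1 hfh) (by simpa only [hnorm] using hs)
    simpa only [hnorm] using this
  refine ⟨⟨fun hi => ?_, ?_⟩, ?_⟩
  · have hs := hInt.1 hi
    set G0 : ℂ := - ∑' n : ℕ, (ζ^(n+1) * tc h n) / (((n:ℂ)+1)*(n+2)) with hG0
    set a : ℂ := f 0 + ζ * G0
    set g : ℂ → ℂ := fun z => (f z - a) / (z - ζ) with hgdef
    have hg : DifferentiableOn ℂ g (ball 0 1) := (hf.sub_const a).div (by fun_prop) hne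
    have h1 : ∀ z ∈ ball (0 : ℂ) 1, f z = a + (z - ζ) * g z := by
      intro z hz
      have := hne z hz
      simp only [hgdef]; field_simp; ring
    refine ⟨a, g, hg, ?_, h1⟩
    have := aux_bwd (fun n => ζ^n * tc g n) (fun n => ζ^(n+1) * tc h n)
      (rel ζ f g h a hg hh h1 hfh) (by simpa only [hnorm] using hs) ?_
    · simp only [hnorm] at this
      exact this
    · rw [← hG0, tc_zero]
      simp only [hgdef, a]
      field_simp
      ring
  · rintro ⟨a, g, hg, hs, h1⟩
    exact hInt.2 (hfwd a g hg hs h1).summable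
  · intro a g hg hs h1
    refine ⟨?_, radlim ζ hζ f g a hg hs h1⟩
    have hS := hfwd a g hg hs h1
    rw [integral_eq_lintegral_of_nonneg_ae hnn hms, hD,
      ← ENNReal.ofReal_tsum_of_nonneg (fun _ => by positivity) hS.summable, hS.tsum_eq,
      ENNReal.toReal_mul, ENNReal.toReal_ofReal hpi.le,
      ENNReal.toReal_ofReal (tsum_nonneg fun _ => by positivity), inv_mul_cancel_left₀ hpi.ne']
    rfl
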